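/- Consider the primal-dual SDP pair max{Tr(CX) : 𝒜(X) = b, X ⪰ 0} and min{⟨b,y⟩ : S = 𝒜*(y) − C, S ⪰ 0}, where 𝒜 : Sym(n) → ℝ^m is a surjective linear map. Assume there exist a positive definite primal feasible X° and y° ∈ ℝ^m with 𝒜*(y°) positive definite, and that for every nonzero y ∈ ℝ^m there exists z ∈ ℝ^m with ⟨b,z⟩ ≠ 0 and Null(𝒜*(y)) ⊆ Null(𝒜*(z)). Then the dual SDP has a unique optimal solution. -/

import Mathlib

open Matrix

open scoped MatrixOrder Matrix.Norms.L2Operator in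
lemma psd_factor {n : ℕ} {S : Matrix (Fin n) (Fin n) ℝ} (hS : S.PosSemidef) :
    ∃ R : Matrix (Fin n) (Fin n) ℝ, S = Rᵀ * R := by
  obtain ⟨B, hB⟩ := CStarAlgebra.nonneg_iff_eq_star_mul_self.mp hS.nonneg
  refine ⟨B, ?_⟩
  rw [hB, star_eq_conjTranspose, conjTranspose_eq_transpose_of_trivial]

lemma psd_iff {n : ℕ} {S : Matrix (Fin n) (Fin n) ℝ} (hs : S.IsSymm) :
    S.PosSemidef ↔ ∀ x : Fin n → ℝ, 0 ≤ x ⬝ᵥ (S *ᵥ x) := by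
  constructor
  · intro h x
    simpa using h.dotProduct_mulVec_nonneg x
  · intro h
    refine PosSemidef.of_dotProduct_mulVec_nonneg ?_ (fun x => by simpa using h x)
    rw [IsHermitian, conjTranspose_eq_transpose_of_trivial]
    exact hs

lemma psd_symm {n : ℕ} {S : Matrix (Fin n) (Fin n) ℝ} (hS : S.PosSemidef) : S.IsSymm := by
  have := hS.isHermitian
  rwa [IsHermitian, conjTranspose_eq_transpose_of_trivial] at this

lemma quad_bound {n : ℕ} (M : Matrix (Fin n) (Fin n) ℝ) :
    ∃ K : ℝ, 0 < K ∧ ∀ w : Fin n → ℝ, |w ⬝ᵥ (M *ᵥ w)| ≤ K * (w ⬝ᵥ w) := by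
  refine ⟨∑ i, ∑ j, |M i j| + 1, by positivity, fun w => ?_⟩
  have hw : ∀ i, w i ^ 2 ≤ w ⬝ᵥ w := by
    intro i
    rw [pow_two]
    exact Finset.single_le_sum (f := fun i => w i * w i)
      (fun i _ => mul_self_nonneg (w i)) (Finset.mem_univ i)
  have h0 : 0 ≤ w ⬝ᵥ w := Finset.sum_nonneg (fun i _ => mul_self_nonneg (w i))
  have h1 : |w ⬝ᵥ (M *ᵥ w)| ≤ ∑ i, ∑ j, |M i j| * (w ⬝ᵥ w) := by
    have : w ⬝ᵥ (M *ᵥ w) = ∑ i, ∑ j, w i * (M i j * w j) := by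
      simp only [dotProduct, mulVec, Finset.mul_sum]
    rw [this]
    refine (Finset.abs_sum_le_sum_abs _ _).trans (Finset.sum_le_sum fun i _ => ?_)
    refine (Finset.abs_sum_le_sum_abs _ _).trans (Finset.sum_le_sum fun j _ => ?_)
    have e : |w i * (M i j * w j)| = |M i j| * |w i * w j| := by
      rw [← abs_mul]; congr 1; ring
    rw [e]
    refine mul_le_mul_of_nonneg_left ?_ (abs_nonneg _)
    rw [abs_le]
    constructor <;> nlinarith [hw i, hw j, sq_nonneg (w i + w j), sq_nonneg (w i - w j)]
  simp only [← Finset.sum_mul] at h1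
  linarith

lemma gen_inv {n : ℕ} (R : Matrix (Fin n) (Fin n) ℝ) :
    ∃ G : Matrix (Fin n) (Fin n) ℝ, R * G * R = R := by
  obtain ⟨g, hg⟩ := (toLin' R).rangeRestrict.exists_rightInverse_of_surjective
    (toLin' R).range_rangeRestrict
  obtain ⟨G, hG⟩ := g.exists_extend
  refine ⟨LinearMap.toMatrix' G, ?_⟩
  apply toLin'.injective
  rw [toLin'_mul, toLin'_mul, toLin'_toMatrix']
  ext1 x
  have h1 := LinearMap.congr_fun hg ((toLin' R).rangeRestrict (LinearMap.single ℝ _ x 1))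
  have h2 := LinearMap.congr_fun hG ((toLin' R).rangeRestrict (LinearMap.single ℝ _ x 1))
  have h3 := congrArg Subtype.val h1
  ext1
  simp only [LinearMap.comp_apply, LinearMap.id_apply] at h1 h2 h3 ⊢
  rw [← h2] at h3
  exact h3

lemma perturb {n : ℕ} {S T : Matrix (Fin n) (Fin n) ℝ} (hS : S.PosSemidef) (hT : T.IsSymm)
    (hk : ∀ v, S *ᵥ v = 0 → T *ᵥ v = 0) :
    ∃ ε : ℝ, 0 < ε ∧ (S + ε • T).PosSemidef ∧ (S - ε • T).PosSemidef := by
  obtain ⟨R, hR⟩ := psd_factor hS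
  obtain ⟨G, hG⟩ := gen_inv R
  have hTG : T * (G * R) = T := by
    have : T * (G * R - 1) = 0 := by
      apply toLin'.injective
      ext1 i
      ext1
      simp only [LinearMap.comp_apply, map_zero, LinearMap.zero_apply, toLin'_apply]
      rw [← mulVec_mulVec]
      apply hk
      rw [mulVec_mulVec, hR, mul_sub, mul_one, Matrix.mul_assoc Rᵀ R, ← Matrix.mul_assoc R G R, hG, sub_self, zero_mulVec]
    rwa [mul_sub, mul_one, sub_eq_zero] at this
  have hGT : (G * R)ᵀ * T = T := by
    have := congrArg transpose hTG
    rwa [transpose_mul, hT] at this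
  have hq : ∀ x, x ⬝ᵥ (T *ᵥ x) = (R *ᵥ x) ⬝ᵥ ((Gᵀ * T * G) *ᵥ (R *ᵥ x)) := by
    intro x
    have : T = Rᵀ * ((Gᵀ * T * G) * R) := by
      conv_lhs => rw [← hGT, ← hTG]
      simp only [transpose_mul, Matrix.mul_assoc]
    conv_lhs => rw [this, ← mulVec_mulVec, dotProduct_mulVec, vecMul_transpose, ← mulVec_mulVec]
  have hs : ∀ x, x ⬝ᵥ (S *ᵥ x) = (R *ᵥ x) ⬝ᵥ (R *ᵥ x) := by
    intro x
    rw [hR, ← mulVec_mulVec, dotProduct_mulVec, vecMul_transpose]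
  obtain ⟨K, hK, hb⟩ := quad_bound (Gᵀ * T * G)
  have hSs := psd_symm hS
  refine ⟨K⁻¹, inv_pos.2 hK, ?_, ?_⟩
  · rw [psd_iff (hSs.add (hT.smul _))]
    intro x
    rw [add_mulVec, smul_mulVec, dotProduct_add, dotProduct_smul, hs, hq, smul_eq_mul]
    have := mul_le_mul_of_nonneg_left (abs_le.1 (hb (R *ᵥ x))).1 (inv_pos.2 hK).le
    rw [← neg_mul_eq_mul_neg, inv_mul_cancel_left₀ hK.ne'] at this
    linarith
  · rw [psd_iff (hSs.sub (hT.smul _))]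
    intro x
    rw [sub_mulVec, smul_mulVec, dotProduct_sub, dotProduct_smul, hs, hq, smul_eq_mul]
    have := mul_le_mul_of_nonneg_left (abs_le.1 (hb (R *ᵥ x))).2 (inv_pos.2 hK).le
    rw [inv_mul_cancel_left₀ hK.ne'] at this
    linarith

lemma perturb_pd {n : ℕ} {S T : Matrix (Fin n) (Fin n) ℝ} (hS : S.PosDef) (hT : T.IsSymm) :
    ∃ ε : ℝ, 0 < ε ∧ (S + ε • T).PosSemidef ∧ (S - ε • T).PosSemidef := by
  refine perturb hS.posSemidef hT (fun v hv => ?_)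
  by_cases h : v = 0
  · simp [h]
  · have := hS.dotProduct_mulVec_pos h
    simp [hv] at this

lemma trace_nonneg_psd {n : ℕ} {S X : Matrix (Fin n) (Fin n) ℝ} (hS : S.PosSemidef)
    (hX : X.PosSemidef) : 0 ≤ (S * X).trace := by
  obtain ⟨R, rfl⟩ := psd_factor hS
  rw [Matrix.mul_assoc, trace_mul_comm]
  have := (hX.mul_mul_conjTranspose_same R).trace_nonneg
  rwa [conjTranspose_eq_transpose_of_trivial] at this

/-- Uniqueness of the dual optimal solution for an SDP pair
`max {Tr(CX) : 𝒜(X) = b, X ⪰ 0}` and `min {⟨b,y⟩ : 𝒜*(y) − C ⪰ 0}`.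
Here `A` plays the role of `𝒜` (defined on all of the matrix space, surjective
on symmetric matrices) and `Aadj` is its adjoint `𝒜*`, which takes values in
the symmetric matrices and satisfies the adjoint identity with respect to the
trace inner product. -/
theorem dual_sdp_unique_optimal (n m : ℕ)
    (A : Matrix (Fin n) (Fin n) ℝ →ₗ[ℝ] (Fin m → ℝ))
    (Aadj : (Fin m → ℝ) →ₗ[ℝ] Matrix (Fin n) (Fin n) ℝ)
    (hadj_symm : ∀ y : Fin m → ℝ, (Aadj y).IsSymm)
    (hadj : ∀ (X : Matrix (Fin n) (Fin n) ℝ) (y : Fin m → ℝ),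
      X.IsSymm → (∑ i, A X i * y i) = ((Aadj y) * X).trace)
    (hsurj : ∀ b : Fin m → ℝ, ∃ X : Matrix (Fin n) (Fin n) ℝ, X.IsSymm ∧ A X = b)
    (C : Matrix (Fin n) (Fin n) ℝ) (hC : C.IsSymm)
    (b : Fin m → ℝ)
    (Xslater : Matrix (Fin n) (Fin n) ℝ) (hXslater : Xslater.PosDef)
    (hXfeas : A Xslater = b)
    (yslater : Fin m → ℝ) (hyslater : (Aadj yslater).PosDef)
    (hnull : ∀ y : Fin m → ℝ, y ≠ 0 → ∃ z : Fin m → ℝ,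
      (∑ i, b i * z i) ≠ 0 ∧
        {v : Fin n → ℝ | (Aadj y).mulVec v = 0} ⊆ {v : Fin n → ℝ | (Aadj z).mulVec v = 0}) :
    ∃! y : Fin m → ℝ,
      (Aadj y - C).PosSemidef ∧
        ∀ y' : Fin m → ℝ, (Aadj y' - C).PosSemidef →
          (∑ i, b i * y i) ≤ (∑ i, b i * y' i) := by
  have hsymm : ∀ y, (Aadj y - C).IsSymm := fun y => (hadj_symm y).sub hC
  have hXs := psd_symm hXslater.posSemidef
  -- the objective in terms of the slack
  have hobj : ∀ y, ∑ i, b i * y i = ((Aadj y - C) * Xslater).trace + (C * Xslater).trace := by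
    intro y
    rw [← hXfeas, hadj _ _ hXs, sub_mul, trace_sub]; ring
  -- feasible point
  obtain ⟨y0, hy0⟩ : ∃ y0, (Aadj y0 - C).PosSemidef := by
    obtain ⟨ε, hε, -, h⟩ := perturb_pd hyslater hC
    refine ⟨ε⁻¹ • yslater, ?_⟩
    have := h.smul (inv_pos.2 hε).le
    rwa [smul_sub, smul_smul, inv_mul_cancel₀ hε.ne', one_smul, ← map_smul] at this
  -- existence
  obtain ⟨ys, hys, hopt⟩ : ∃ y, (Aadj y - C).PosSemidef ∧ ∀ y', (Aadj y' - C).PosSemidef →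
      (∑ i, b i * y i) ≤ (∑ i, b i * y' i) := by
    choose Xi hXis hXi using fun i : Fin m => hsurj (Pi.single i 1)
    choose ε hε hp hm using fun i : Fin m => perturb_pd hXslater (hXis i)
    set c := (∑ i, b i * y0 i) - (C * Xslater).trace with hc
    have hyi : ∀ y i, y i = ((Aadj y - C) * Xi i).trace + (C * Xi i).trace := by
      intro y i
      have := hadj (Xi i) y (hXis i)
      rw [hXi] at this
      rw [sub_mul, trace_sub, ← this]
      simp [Pi.single_apply]
    let F : Set (Fin m → ℝ) := {y | (Aadj y - C).PosSemidef ∧ ∑ i, b i * y i ≤ ∑ i, b i * y0 i}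
    have hcont : Continuous fun y : Fin m → ℝ => ∑ i, b i * y i := by fun_prop
    have hclosed : IsClosed F := by
      have : F = (⋂ x : Fin n → ℝ, {y | 0 ≤ x ⬝ᵥ ((Aadj y - C) *ᵥ x)}) ∩
          {y | ∑ i, b i * y i ≤ ∑ i, b i * y0 i} := by
        ext y
        simp [F, psd_iff (hsymm y)]
      rw [this]
      refine (isClosed_iInter fun x => isClosed_le continuous_const ?_).inter
        (isClosed_le hcont continuous_const)
      have hA : Continuous Aadj := Aadj.continuous_of_finiteDimensional
      exact continuous_const.dotProduct ((hA.sub continuous_const).matrix_mulVec continuous_const)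
    have hsub : F ⊆ Set.Icc (fun i => (C * Xi i).trace - (ε i)⁻¹ * c)
        (fun i => (C * Xi i).trace + (ε i)⁻¹ * c) := by
      rintro y ⟨hy, hyb⟩
      have hle : ((Aadj y - C) * Xslater).trace ≤ c := by
        have := hobj y
        rw [hc]; linarith
      have key : ∀ i, ε i * (ε i)⁻¹ = 1 := fun i => mul_inv_cancel₀ (hε i).ne'
      refine ⟨fun i => ?_, fun i => ?_⟩
      · have h := trace_nonneg_psd hy (hp i)
        rw [mul_add, Matrix.mul_smul, trace_add, trace_smul, smul_eq_mul] at h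
        have h2 : 0 ≤ (ε i)⁻¹ * (c + ε i * ((Aadj y - C) * Xi i).trace) :=
          mul_nonneg (inv_pos.2 (hε i)).le (by linarith)
        rw [mul_add, inv_mul_cancel_left₀ (hε i).ne'] at h2
        have := hyi y i
        show _ ≤ y i
        linarith
      · have h := trace_nonneg_psd hy (hm i)
        rw [mul_sub, Matrix.mul_smul, trace_sub, trace_smul, smul_eq_mul] at h
        have h2 : 0 ≤ (ε i)⁻¹ * (c - ε i * ((Aadj y - C) * Xi i).trace) :=
          mul_nonneg (inv_pos.2 (hε i)).le (by linarith)
        rw [mul_sub, inv_mul_cancel_left₀ (hε i).ne'] at h2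
        have := hyi y i
        show y i ≤ _
        linarith
    have hcomp : IsCompact F := isCompact_Icc.of_isClosed_subset hclosed hsub
    obtain ⟨y, hyF, hmin⟩ := hcomp.exists_isMinOn ⟨y0, hy0, le_rfl⟩ hcont.continuousOn
    refine ⟨y, hyF.1, fun y' hy' => ?_⟩
    by_cases h : ∑ i, b i * y' i ≤ ∑ i, b i * y0 i
    · exact hmin (show y' ∈ F from ⟨hy', h⟩)
    · exact hyF.2.trans (not_le.1 h).le
  refine ⟨ys, ⟨hys, hopt⟩, ?_⟩
  rintro y ⟨hy, hyopt⟩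
  by_contra hne
  obtain ⟨z, hz, hzn⟩ := hnull (y - ys) (sub_ne_zero.2 hne)
  have heq : ∑ i, b i * y i = ∑ i, b i * ys i := le_antisymm (hyopt _ hys) (hopt _ hy)
  have hk : ∀ v, ((Aadj y - C) + (Aadj ys - C)) *ᵥ v = 0 → Aadj z *ᵥ v = 0 := by
    intro v hv
    apply hzn
    have h1 := (psd_iff (hsymm y)).1 hy v
    have h2 := (psd_iff (hsymm ys)).1 hys v
    have h3 : v ⬝ᵥ ((Aadj y - C) *ᵥ v) + v ⬝ᵥ ((Aadj ys - C) *ᵥ v) = 0 := by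
      rw [← dotProduct_add, ← add_mulVec, hv, dotProduct_zero]
    have h4 : (Aadj y - C) *ᵥ v = 0 := by
      rw [← hy.dotProduct_mulVec_zero_iff]; simp only [star_trivial]; linarith
    have h5 : (Aadj ys - C) *ᵥ v = 0 := by
      rw [← hys.dotProduct_mulVec_zero_iff]; simp only [star_trivial]; linarith
    show Aadj (y - ys) *ᵥ v = 0
    have : Aadj (y - ys) = (Aadj y - C) - (Aadj ys - C) := by rw [map_sub]; abel
    rw [this, sub_mulVec, h4, h5, sub_zero]
  obtain ⟨ε, hε, hp, hm⟩ := perturb (hy.add hys) (hadj_symm z) hk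
  have gen : ∀ t : ℝ, ((Aadj y - C) + (Aadj ys - C) + t • Aadj z).PosSemidef →
      0 ≤ t * ∑ i, b i * z i := by
    intro t ht
    have h1 := ht.smul (show (0 : ℝ) ≤ 1 / 2 by norm_num)
    have h2 : (1 / 2 : ℝ) • ((Aadj y - C) + (Aadj ys - C) + t • Aadj z) =
        Aadj ((1 / 2 : ℝ) • (y + ys + t • z)) - C := by
      simp only [map_smul, map_add]
      module
    rw [h2] at h1
    have h3 := hopt _ h1
    have h4 : ∑ i, b i * ((1 / 2 : ℝ) • (y + ys + t • z)) i =
        1 / 2 * (∑ i, b i * y i + ∑ i, b i * ys i + t * ∑ i, b i * z i) := by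
      simp only [Finset.mul_sum, ← Finset.sum_add_distrib]
      refine Finset.sum_congr rfl fun i _ => ?_
      simp only [Pi.smul_apply, Pi.add_apply, smul_eq_mul]
      ring
    rw [h4, heq] at h3
    linarith
  have g1 := gen ε hp
  have g2 := gen (-ε) (by rwa [neg_smul, ← sub_eq_add_neg])
  have : ε * ∑ i, b i * z i = 0 := by linarith
  exact (mul_ne_zero hε.ne' hz) this
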